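/- Let n ≥ 1, k > 0, δ > 0, g₁ > 0, and suppose there exist positive constants χ, λ₀, λ₁ such that Φ₀ is positive definite, Ψ₁ = −k + (1 + k²n)χ ≤ 0, and Ψ₂ is negative semidefinite. Then every classical (C²) solution e : Ω × [t₀,∞) → ℝ of the forward error system satisfies, for all t ≥ t₀, ∫_Ω (|∇e(x,t)|² + e_t(x,t)²) dx ≤ (β/α) e^{−2δ(t−t₀)} ∫_Ω (|∇e(x,t₀)|² + e_t(x,t₀)²) dx, where α = 2λ_min(Φ₀) and β = 2(1 + 4/(π²n))λ_max(Φ₁) + χk(n−1) with Φ₁ = Φ₀ + diag(4λ₀/(π²n), 0, 0). -/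

import Mathlib

open MeasureTheory Real Matrix

noncomputable section

/-- The closed unit hypercube `[0,1]^n`. -/
def cube (n : ℕ) : Set (Fin n → ℝ) := Set.univ.pi fun _ => Set.Icc (0:ℝ) 1

/-- Partial derivative of `u` in the `p`-th coordinate direction. -/
def pd {n : ℕ} (p : Fin n) (u : (Fin n → ℝ) → ℝ) (x : Fin n → ℝ) : ℝ :=
  fderiv ℝ u x (Pi.single p 1)

/-- Squared Euclidean norm of the gradient, `|∇u|²`. -/
def gradSq {n : ℕ} (u : (Fin n → ℝ) → ℝ) (x : Fin n → ℝ) : ℝ := ∑ p, (pd p u x) ^ 2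

/-- Laplacian `Δu = Σ_p u_{x_p x_p}`. -/
def lap {n : ℕ} (u : (Fin n → ℝ) → ℝ) (x : Fin n → ℝ) : ℝ := ∑ p, pd p (pd p u) x

/-- Surface integral over `Γ_N`: `Σ_p ∫_{[0,1]^{n-1}} h|_{x_p = 1} dx'`
(each face integral realized as an integral over the cube of a function
independent of the `p`-th coordinate). -/
def faceInt {n : ℕ} (h : (Fin n → ℝ) → ℝ) : ℝ :=
  ∑ p : Fin n, ∫ x in cube n, h (Function.update x p 1)

/-- `xᵀ∇u`. -/
def xGrad {n : ℕ} (u : (Fin n → ℝ) → ℝ) (x : Fin n → ℝ) : ℝ := ∑ p, x p * pd p u x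

/-- Minimal eigenvalue of a symmetric matrix, via the Rayleigh quotient. -/
def lamMin (M : Matrix (Fin 3) (Fin 3) ℝ) : ℝ :=
  sInf {r | ∃ v : Fin 3 → ℝ, (∑ i, (v i) ^ 2) = 1 ∧ r = v ⬝ᵥ M.mulVec v}

/-- Maximal eigenvalue of a symmetric matrix, via the Rayleigh quotient. -/
def lamMax (M : Matrix (Fin 3) (Fin 3) ℝ) : ℝ :=
  sSup {r | ∃ v : Fin 3 → ℝ, (∑ i, (v i) ^ 2) = 1 ∧ r = v ⬝ᵥ M.mulVec v}

/-- Negative definiteness. -/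
def NegDefM {m : ℕ} (M : Matrix (Fin m) (Fin m) ℝ) : Prop := (-M).PosDef

/-- Negative semidefiniteness. -/
def NegSemidefM {m : ℕ} (M : Matrix (Fin m) (Fin m) ℝ) : Prop := (-M).PosSemidef

/-- The matrix `Φ₀` of LMI (12). -/
def Phi0 (n : ℕ) (χ lam0 : ℝ) : Matrix (Fin 3) (Fin 3) ℝ :=
  !![1/2 - 4*lam0/(π^2*n), Real.sqrt n * χ, 0;
     Real.sqrt n * χ, 1/2, ((n:ℝ)-1)*χ/2;
     0, ((n:ℝ)-1)*χ/2, lam0]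

/-- `Φ₁ = Φ₀ + diag(4λ₀/(π²n), 0, 0)`. -/
def Phi1 (n : ℕ) (χ lam0 : ℝ) : Matrix (Fin 3) (Fin 3) ℝ :=
  Phi0 n χ lam0 + Matrix.diagonal ![4*lam0/(π^2*n), 0, 0]

/-- The matrix `Ψ₂` of LMI (14). -/
def Psi2 (n : ℕ) (k χ δ g1 lam1 : ℝ) : Matrix (Fin 3) (Fin 3) ℝ :=
  !![-χ + δ*(1 + χ*k*((n:ℝ)-1)) + 4*lam1/(π^2*n), 2*δ*Real.sqrt n*χ, Real.sqrt n*g1*χ;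
     2*δ*Real.sqrt n*χ, -χ + δ, g1/2 + δ*((n:ℝ)-1)*χ;
     Real.sqrt n*g1*χ, g1/2 + δ*((n:ℝ)-1)*χ, -lam1 + g1*((n:ℝ)-1)*χ]

/-- The matrix `Φ` of the exact-observability LMI (32), with `σ = e^{-2δT*}`. -/
def PhiM (n : ℕ) (χ σ lam2 : ℝ) : Matrix (Fin 3) (Fin 3) ℝ :=
  !![-(1-σ)/2 + 4*lam2/(π^2*n), Real.sqrt n*(1+σ)*χ, 0;
     Real.sqrt n*(1+σ)*χ, -(1-σ)/2, ((n:ℝ)-1)*(1+σ)*χ/2;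
     0, ((n:ℝ)-1)*(1+σ)*χ/2, -lam2]

/-- `α = 2λ_min(Φ₀)`. -/
def alphaC (n : ℕ) (χ lam0 : ℝ) : ℝ := 2 * lamMin (Phi0 n χ lam0)

/-- `β = 2(1 + 4/(π²n))λ_max(Φ₁) + χk(n−1)`. -/
def betaC (n : ℕ) (k χ lam0 : ℝ) : ℝ :=
  2 * (1 + 4/(π^2*n)) * lamMax (Phi1 n χ lam0) + χ*k*((n:ℝ)-1)

lemma measurableSet_cube (n : ℕ) : MeasurableSet (cube n) :=
  MeasurableSet.univ_pi fun _ => measurableSet_Icc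

lemma isCompact_cube (n : ℕ) : IsCompact (cube n) :=
  isCompact_univ_pi fun _ => isCompact_Icc

lemma Continuous.integrableOn_cube {n : ℕ} {f : (Fin n → ℝ) → ℝ} (hf : Continuous f) :
    IntegrableOn f (cube n) :=
  hf.continuousOn.integrableOn_compact (isCompact_cube n)

lemma update_mem_cube {n : ℕ} {x : Fin n → ℝ} (hx : x ∈ cube n) (p : Fin n) {s : ℝ}
    (hs : s ∈ Set.Icc (0 : ℝ) 1) : Function.update x p s ∈ cube n := by
  intro q _
  rcases eq_or_ne q p with rfl | hq
  · simpa using hs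
  · simpa [hq] using hx q trivial

/-- Resampling one coordinate preserves the uniform measure on the cube. -/
lemma measurePreserving_update_cube {n : ℕ} (p : Fin n) :
    MeasurePreserving (fun z : (Fin n → ℝ) × ℝ => Function.update z.1 p z.2)
      ((volume.restrict (cube n)).prod (volume.restrict (Set.Icc (0 : ℝ) 1)))
      (volume.restrict (cube n)) := by
  have hμ : (volume : Measure (Fin n → ℝ)).restrict (cube n) =
      Measure.pi fun _ => (volume : Measure ℝ).restrict (Set.Icc 0 1) := by
    rw [cube, volume_pi, Measure.restrict_pi_pi]
  have hmeas : Measurable fun z : (Fin n → ℝ) × ℝ => Function.update z.1 p z.2 := by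
    refine measurable_pi_lambda _ fun q => ?_
    rcases eq_or_ne q p with rfl | hq
    · simpa using measurable_snd
    · simpa [hq, Function.comp_def] using (measurable_pi_apply q).comp measurable_fst
  refine ⟨hmeas, ?_⟩
  rw [hμ]
  refine (Measure.pi_eq fun s hs => ?_).symm
  rw [Measure.map_apply hmeas (MeasurableSet.univ_pi hs)]
  have hpre : (fun z : (Fin n → ℝ) × ℝ => Function.update z.1 p z.2) ⁻¹' Set.univ.pi s =
      (Set.univ.pi (Function.update s p Set.univ)) ×ˢ s p := by
    ext ⟨x, y⟩
    simp only [Set.mem_preimage, Set.mem_pi, Set.mem_univ, true_implies, Set.mem_prod]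
    constructor
    · intro h
      refine ⟨fun q => ?_, by simpa using h p⟩
      rcases eq_or_ne q p with rfl | hq
      · simp
      · simpa [hq] using h q
    · rintro ⟨h, hy⟩ q
      rcases eq_or_ne q p with rfl | hq
      · simpa using hy
      · simpa [hq] using h q
  rw [hpre, Measure.prod_prod, Measure.pi_pi,
    ← Finset.mul_prod_erase Finset.univ _ (Finset.mem_univ p),
    ← Finset.mul_prod_erase Finset.univ (fun i => (volume.restrict (Set.Icc (0 : ℝ) 1)) (s i))
      (Finset.mem_univ p)]
  have h1 : (volume.restrict (Set.Icc (0 : ℝ) 1)) (Function.update s p Set.univ p) = 1 := by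
    simp
  rw [h1, one_mul, mul_comm]
  congr 1
  refine Finset.prod_congr rfl fun q hq => ?_
  simp [Finset.ne_of_mem_erase hq]

/-- Fubini on the cube, integrating first over a line in the direction `p`. -/
lemma integral_cube_eq_integral_line {n : ℕ} (p : Fin n) {F : (Fin n → ℝ) → ℝ}
    (hF : Continuous F) :
    ∫ x in cube n, F x = ∫ x in cube n, ∫ s in (0 : ℝ)..1, F (Function.update x p s) := by
  have hmp := measurePreserving_update_cube p
  have hint : Integrable (fun z : (Fin n → ℝ) × ℝ => F (Function.update z.1 p z.2))
      ((volume.restrict (cube n)).prod (volume.restrict (Set.Icc (0 : ℝ) 1))) :=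
    hmp.integrable_comp_of_integrable hF.integrableOn_cube
  rw [← hmp.map_eq, integral_map hmp.measurable.aemeasurable
    hF.aestronglyMeasurable, integral_prod _ hint, hmp.map_eq]
  refine integral_congr_ae (Filter.Eventually.of_forall fun x => ?_)
  simp only
  rw [intervalIntegral.integral_of_le zero_le_one, integral_Icc_eq_integral_Ioc]

lemma continuous_integral_line {n : ℕ} (p : Fin n) {F : (Fin n → ℝ) → ℝ}
    (hF : Continuous F) :
    Continuous fun x => ∫ s in (0 : ℝ)..1, F (Function.update x p s) := by
  refine intervalIntegral.continuous_parametric_intervalIntegral_of_continuous' ?_ 0 1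
  exact hF.comp (continuous_fst.update p continuous_snd)

lemma hasDerivAt_comp_update {n : ℕ} (p : Fin n) {u : (Fin n → ℝ) → ℝ}
    (hu : ContDiff ℝ 1 u) (x : Fin n → ℝ) (s : ℝ) :
    HasDerivAt (fun s => u (Function.update x p s)) (pd p u (Function.update x p s)) s :=
  ((hu.differentiable one_ne_zero _).hasFDerivAt).comp_hasDerivAt s (hasDerivAt_update x p s)

lemma ContDiff.pd {n : ℕ} {m : WithTop ℕ∞} (p : Fin n) {u : (Fin n → ℝ) → ℝ}
    (hu : ContDiff ℝ (m + 1) u) : ContDiff ℝ m (pd p u) :=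
  (hu.fderiv_right le_rfl).clm_apply contDiff_const

lemma ContDiff.continuous_pd {n : ℕ} (p : Fin n) {u : (Fin n → ℝ) → ℝ}
    (hu : ContDiff ℝ 1 u) : Continuous (_root_.pd p u) :=
  (hu.continuous_fderiv one_ne_zero).clm_apply continuous_const

/-- The divergence theorem on the cube, one direction at a time. -/
lemma integral_cube_pd {n : ℕ} (p : Fin n) {u : (Fin n → ℝ) → ℝ} (hu : ContDiff ℝ 1 u) :
    ∫ x in cube n, pd p u x =
      ∫ x in cube n, (u (Function.update x p 1) - u (Function.update x p 0)) := by
  have hc := hu.continuous_pd p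
  rw [integral_cube_eq_integral_line p hc]
  refine integral_congr_ae (Filter.Eventually.of_forall fun x => ?_)
  exact intervalIntegral.integral_eq_sub_of_hasDerivAt
    (fun s _ => hasDerivAt_comp_update p hu x s)
    ((hc.comp (continuous_const.update p continuous_id)).intervalIntegrable 0 1)

lemma sq_le_integral_deriv_sq {f f' : ℝ → ℝ} (hf : ∀ s, HasDerivAt f (f' s) s)
    (hf' : Continuous f') (h0 : f 0 = 0) : f 1 ^ 2 ≤ ∫ s in (0 : ℝ)..1, f' s ^ 2 := by
  have hint : ∫ s in (0 : ℝ)..1, f' s = f 1 := by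
    rw [intervalIntegral.integral_eq_sub_of_hasDerivAt (fun s _ => hf s)
      (hf'.intervalIntegrable 0 1), h0, sub_zero]
  have hmono : ∫ s in (0 : ℝ)..1, (2 * f 1 * f' s - f 1 ^ 2) ≤ ∫ s in (0 : ℝ)..1, f' s ^ 2 :=
    intervalIntegral.integral_mono_on zero_le_one
      ((by fun_prop : Continuous fun s => 2 * f 1 * f' s - f 1 ^ 2).intervalIntegrable 0 1)
      ((hf'.pow 2).intervalIntegrable 0 1) fun s _ => by nlinarith [sq_nonneg (f' s - f 1)]
  rw [intervalIntegral.integral_sub ((hf'.const_mul _).intervalIntegrable 0 1)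
    (by simp), intervalIntegral.integral_const_mul, hint] at hmono
  simp at hmono
  nlinarith

lemma mul_integral_sq_le_of_lt {f f' : ℝ → ℝ} (hf : ∀ s, HasDerivAt f (f' s) s)
    (hf' : Continuous f') (h0 : f 0 = 0) {θ : ℝ} (hθ0 : 0 < θ) (hθ : θ < π / 2) :
    θ ^ 2 * ∫ s in (0 : ℝ)..1, f s ^ 2 ≤ ∫ s in (0 : ℝ)..1, f' s ^ 2 := by
  have hfc : Continuous f := continuous_iff_continuousAt.2 fun s => (hf s).continuousAt
  have hcos : ∀ s ∈ Set.uIcc (0 : ℝ) 1, 0 < cos (θ * (1 - s)) := by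
    intro s hs
    rw [Set.uIcc_of_le zero_le_one] at hs
    refine cos_pos_of_mem_Ioo ⟨?_, ?_⟩ <;> nlinarith [hs.1, hs.2, pi_pos]
  set a : ℝ → ℝ := fun s => θ * tan (θ * (1 - s))
  set b : ℝ → ℝ := fun s => (-θ ^ 2 - a s ^ 2) * f s ^ 2 + a s * (2 * f s * f' s)
  have ha : ∀ s ∈ Set.uIcc (0 : ℝ) 1, HasDerivAt a (-θ ^ 2 - a s ^ 2) s := by
    intro s hs
    have h := ((hasDerivAt_tan (hcos s hs).ne').comp s
      (((hasDerivAt_id s).const_sub 1).const_mul θ)).const_mul θ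
    refine h.congr_deriv ?_
    have h2 := (hcos s hs).ne'
    have h3 := sin_sq_add_cos_sq (θ * (1 - s))
    simp only [a, tan_eq_sin_div_cos]
    field_simp
    linarith
  have hac : ContinuousOn a (Set.uIcc 0 1) := fun s hs => (ha s hs).continuousAt.continuousWithinAt
  have hbc : ContinuousOn b (Set.uIcc 0 1) := by
    have h1 := hfc.continuousOn (s := Set.uIcc (0 : ℝ) 1)
    have h2 := hf'.continuousOn (s := Set.uIcc (0 : ℝ) 1)
    fun_prop
  have hprim : ∫ s in (0 : ℝ)..1, b s = 0 := by
    rw [intervalIntegral.integral_eq_sub_of_hasDerivAt (f := fun s => a s * f s ^ 2)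
      (fun s hs => ?_) hbc.intervalIntegrable]
    · simp [a, h0]
    · refine ((ha s hs).mul ((hf s).pow 2)).congr_deriv ?_
      simp only [b]
      norm_num
  have hfi : IntervalIntegrable (fun s => θ ^ 2 * f s ^ 2) volume 0 1 :=
    ((hfc.pow 2).const_mul _).intervalIntegrable 0 1
  have hmono : ∫ s in (0 : ℝ)..1, (θ ^ 2 * f s ^ 2 + b s) ≤ ∫ s in (0 : ℝ)..1, f' s ^ 2 := by
    refine intervalIntegral.integral_mono_on zero_le_one
      (hfi.add hbc.intervalIntegrable)
      ((hf'.pow 2).intervalIntegrable 0 1) fun s _ => ?_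
    simp only [b]
    nlinarith [sq_nonneg (f' s - a s * f s)]
  rwa [intervalIntegral.integral_add hfi hbc.intervalIntegrable, hprim, add_zero,
    intervalIntegral.integral_const_mul] at hmono

/-- Wirtinger's inequality on `[0,1]` for functions vanishing at the left end point. -/
lemma wirtinger_interval {f f' : ℝ → ℝ} (hf : ∀ s, HasDerivAt f (f' s) s)
    (hf' : Continuous f') (h0 : f 0 = 0) :
    (π / 2) ^ 2 * ∫ s in (0 : ℝ)..1, f s ^ 2 ≤ ∫ s in (0 : ℝ)..1, f' s ^ 2 := by
  have hlim : Filter.Tendsto (fun θ : ℝ => θ ^ 2 * ∫ s in (0 : ℝ)..1, f s ^ 2)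
      (nhdsWithin (π / 2) (Set.Iio (π / 2))) (nhds ((π / 2) ^ 2 * ∫ s in (0 : ℝ)..1, f s ^ 2)) :=
    (by fun_prop : Continuous fun θ : ℝ => θ ^ 2 * ∫ s in (0 : ℝ)..1, f s ^ 2).tendsto _
      |>.mono_left nhdsWithin_le_nhds
  refine le_of_tendsto hlim ?_
  filter_upwards [Ioo_mem_nhdsLT (by positivity : (0 : ℝ) < π / 2)] with θ hθ
  exact mul_integral_sq_le_of_lt hf hf' h0 hθ.1 hθ.2

lemma integral_cube_mono {n : ℕ} {f h : (Fin n → ℝ) → ℝ} (hf : Continuous f)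
    (hh : Continuous h) (hle : ∀ x ∈ cube n, f x ≤ h x) :
    ∫ x in cube n, f x ≤ ∫ x in cube n, h x :=
  setIntegral_mono_on hf.integrableOn_cube hh.integrableOn_cube (measurableSet_cube n) hle

lemma integral_cube_add {n : ℕ} {f h : (Fin n → ℝ) → ℝ} (hf : Continuous f)
    (hh : Continuous h) :
    ∫ x in cube n, (f x + h x) = (∫ x in cube n, f x) + ∫ x in cube n, h x :=
  integral_add hf.integrableOn_cube hh.integrableOn_cube

lemma integral_cube_sub {n : ℕ} {f h : (Fin n → ℝ) → ℝ} (hf : Continuous f)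
    (hh : Continuous h) :
    ∫ x in cube n, (f x - h x) = (∫ x in cube n, f x) - ∫ x in cube n, h x :=
  integral_sub hf.integrableOn_cube hh.integrableOn_cube

lemma integral_cube_sum {n : ℕ} {f : Fin n → (Fin n → ℝ) → ℝ} (hf : ∀ p, Continuous (f p)) :
    ∫ x in cube n, ∑ p, f p x = ∑ p, ∫ x in cube n, f p x :=
  integral_finsetSum _ fun p _ => (hf p).integrableOn_cube

lemma Continuous.comp_update {n : ℕ} (p : Fin n) (s : ℝ) {u : (Fin n → ℝ) → ℝ}
    (hu : Continuous u) : Continuous fun x => u (Function.update x p s) :=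
  hu.comp (continuous_id.update p continuous_const)

lemma ContDiff.continuous_gradSq {n : ℕ} {u : (Fin n → ℝ) → ℝ} (hu : ContDiff ℝ 1 u) :
    Continuous (gradSq u) :=
  continuous_finsetSum _ fun p _ => (hu.continuous_pd p).pow 2

lemma ContDiff.continuous_xGrad {n : ℕ} {u : (Fin n → ℝ) → ℝ} (hu : ContDiff ℝ 1 u) :
    Continuous (xGrad u) :=
  continuous_finsetSum _ fun p _ => (continuous_apply p).mul (hu.continuous_pd p)

lemma update_zero_eq_zero {n : ℕ} {u : (Fin n → ℝ) → ℝ}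
    (h0 : ∀ x ∈ cube n, (∃ p, x p = 0) → u x = 0) (p : Fin n) {x : Fin n → ℝ}
    (hx : x ∈ cube n) : u (Function.update x p 0) = 0 :=
  h0 _ (update_mem_cube hx p (by simp)) ⟨p, by simp⟩

lemma integral_cube_sq_le_pd {n : ℕ} (p : Fin n) {u : (Fin n → ℝ) → ℝ} (hu : ContDiff ℝ 1 u)
    (h0 : ∀ x ∈ cube n, (∃ p, x p = 0) → u x = 0) :
    (π / 2) ^ 2 * ∫ x in cube n, u x ^ 2 ≤ ∫ x in cube n, pd p u x ^ 2 := by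
  have hu2 : Continuous fun x => u x ^ 2 := hu.continuous.pow 2
  have hp2 : Continuous fun x => pd p u x ^ 2 := (hu.continuous_pd p).pow 2
  rw [integral_cube_eq_integral_line p hu2, integral_cube_eq_integral_line p hp2,
    ← integral_const_mul]
  refine integral_cube_mono ((continuous_integral_line p hu2).const_mul _)
    (continuous_integral_line p hp2) fun x hx => ?_
  exact wirtinger_interval (fun s => hasDerivAt_comp_update p hu x s)
    ((hu.continuous_pd p).comp (continuous_const.update p continuous_id))
    (update_zero_eq_zero h0 p hx)

/-- Poincaré's inequality on the cube with the sharp constant. -/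
lemma poincare_cube {n : ℕ} (hn : 1 ≤ n) {u : (Fin n → ℝ) → ℝ} (hu : ContDiff ℝ 1 u)
    (h0 : ∀ x ∈ cube n, (∃ p, x p = 0) → u x = 0) :
    ∫ x in cube n, u x ^ 2 ≤ 4 / (π ^ 2 * n) * ∫ x in cube n, gradSq u x := by
  have hsum : ∑ _p : Fin n, (π / 2) ^ 2 * ∫ x in cube n, u x ^ 2 ≤ ∫ x in cube n, gradSq u x := by
    unfold gradSq
    rw [integral_cube_sum (f := fun p x => pd p u x ^ 2) fun p => (hu.continuous_pd p).pow 2]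
    exact Finset.sum_le_sum fun p _ => integral_cube_sq_le_pd p hu h0
  have hn' : (0 : ℝ) < n := by exact_mod_cast hn
  rw [Finset.sum_const, Finset.card_univ, Fintype.card_fin, nsmul_eq_mul] at hsum
  rw [div_mul_eq_mul_div, le_div_iff₀ (by positivity)]
  linarith

/-- The trace on the faces `x_p = 1` is controlled by the gradient. -/
lemma integral_cube_trace_le {n : ℕ} {u : (Fin n → ℝ) → ℝ} (hu : ContDiff ℝ 1 u)
    (h0 : ∀ x ∈ cube n, (∃ p, x p = 0) → u x = 0) :
    ∫ x in cube n, ∑ p, u (Function.update x p 1) ^ 2 ≤ ∫ x in cube n, gradSq u x := by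
  unfold gradSq
  rw [integral_cube_sum (f := fun p x => u (Function.update x p 1) ^ 2)
      fun p => (hu.continuous.comp_update p 1).pow 2,
    integral_cube_sum (f := fun p x => pd p u x ^ 2) fun p => (hu.continuous_pd p).pow 2]
  refine Finset.sum_le_sum fun p _ => ?_
  have hp2 : Continuous fun x => pd p u x ^ 2 := (hu.continuous_pd p).pow 2
  rw [integral_cube_eq_integral_line p hp2]
  refine integral_cube_mono ((hu.continuous.comp_update p 1).pow 2)
    (continuous_integral_line p hp2) fun x hx => ?_
  exact sq_le_integral_deriv_sq (fun s => hasDerivAt_comp_update p hu x s)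
    ((hu.continuous_pd p).comp (continuous_const.update p continuous_id))
    (update_zero_eq_zero h0 p hx)

lemma gradSq_nonneg {n : ℕ} (u : (Fin n → ℝ) → ℝ) (x : Fin n → ℝ) : 0 ≤ gradSq u x :=
  Finset.sum_nonneg fun _ _ => sq_nonneg _

lemma sum_sq_le_of_mem_cube {n : ℕ} {x : Fin n → ℝ} (hx : x ∈ cube n) : ∑ p, x p ^ 2 ≤ n := by
  have h : ∑ p, x p ^ 2 ≤ ∑ _p : Fin n, (1 : ℝ) := Finset.sum_le_sum fun p _ =>
    pow_le_one₀ (hx p trivial).1 (hx p trivial).2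
  simpa using h

lemma xGrad_sq_le {n : ℕ} (u : (Fin n → ℝ) → ℝ) {x : Fin n → ℝ} (hx : x ∈ cube n) :
    xGrad u x ^ 2 ≤ n * gradSq u x :=
  (Finset.sum_mul_sq_le_sq_mul_sq Finset.univ x fun p => pd p u x).trans
    (mul_le_mul_of_nonneg_right (sum_sq_le_of_mem_cube hx) (gradSq_nonneg u x))

lemma abs_xGrad_le {n : ℕ} (u : (Fin n → ℝ) → ℝ) {x : Fin n → ℝ} (hx : x ∈ cube n) :
    |xGrad u x| ≤ √n * √(gradSq u x) := by
  rw [← Real.sqrt_mul (Nat.cast_nonneg n)]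
  exact Real.abs_le_sqrt (xGrad_sq_le u hx)

lemma isCompact_sphere_form (M : Matrix (Fin 3) (Fin 3) ℝ) :
    IsCompact {r | ∃ v : Fin 3 → ℝ, (∑ i, (v i) ^ 2) = 1 ∧ r = v ⬝ᵥ M.mulVec v} := by
  have hs : IsCompact {v : Fin 3 → ℝ | ∑ i, v i ^ 2 = 1} := by
    refine (isCompact_univ_pi fun _ => isCompact_Icc (a := (-1 : ℝ)) (b := 1)).of_isClosed_subset
      (isClosed_eq (by fun_prop) continuous_const) fun v hv i _ => ?_
    have h1 : v i ^ 2 ≤ ∑ j, v j ^ 2 :=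
      Finset.single_le_sum (f := fun j => v j ^ 2) (fun _ _ => sq_nonneg _) (Finset.mem_univ i)
    exact abs_le.1 ((sq_le_one_iff_abs_le_one _).1 (h1.trans hv.le))
  have hc : Continuous fun v : Fin 3 → ℝ => v ⬝ᵥ M.mulVec v := by
    unfold Matrix.mulVec dotProduct
    fun_prop
  convert hs.image hc using 1
  ext r
  simp [eq_comm]

lemma form_normalize (M : Matrix (Fin 3) (Fin 3) ℝ) {v : Fin 3 → ℝ} (hv : 0 < ∑ i, v i ^ 2) :
    ∃ w : Fin 3 → ℝ, ∑ i, w i ^ 2 = 1 ∧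
      v ⬝ᵥ M.mulVec v = (w ⬝ᵥ M.mulVec w) * ∑ i, v i ^ 2 := by
  set N := ∑ i, v i ^ 2 with hN
  have hs : (√N)⁻¹ ^ 2 = N⁻¹ := by rw [inv_pow, Real.sq_sqrt hv.le]
  refine ⟨(√N)⁻¹ • v, ?_, ?_⟩
  · simp only [Pi.smul_apply, smul_eq_mul, mul_pow, hs]
    rw [← Finset.mul_sum, ← hN, inv_mul_cancel₀ hv.ne']
  · rw [Matrix.mulVec_smul, smul_dotProduct, dotProduct_smul, smul_smul, ← sq, hs, smul_eq_mul]
    field_simp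

lemma form_eq_zero_of_sum_sq (M : Matrix (Fin 3) (Fin 3) ℝ) {v : Fin 3 → ℝ}
    (hv : ∑ i, v i ^ 2 = 0) : v ⬝ᵥ M.mulVec v = 0 := by
  have : v = 0 := by
    ext i
    simpa using (Finset.sum_eq_zero_iff_of_nonneg fun _ _ => sq_nonneg _).1 hv i
  simp [this]

lemma lamMin_mul_le (M : Matrix (Fin 3) (Fin 3) ℝ) (v : Fin 3 → ℝ) :
    lamMin M * ∑ i, v i ^ 2 ≤ v ⬝ᵥ M.mulVec v := by
  have hN : 0 ≤ ∑ i, v i ^ 2 := Finset.sum_nonneg fun _ _ => sq_nonneg _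
  rcases hN.eq_or_lt with h | h
  · rw [form_eq_zero_of_sum_sq M h.symm, ← h, mul_zero]
  · obtain ⟨w, hw, hvw⟩ := form_normalize M h
    rw [hvw]
    exact mul_le_mul_of_nonneg_right
      (csInf_le (isCompact_sphere_form M).bddBelow ⟨w, hw, rfl⟩) hN

lemma le_lamMax_mul (M : Matrix (Fin 3) (Fin 3) ℝ) (v : Fin 3 → ℝ) :
    v ⬝ᵥ M.mulVec v ≤ lamMax M * ∑ i, v i ^ 2 := by
  have hN : 0 ≤ ∑ i, v i ^ 2 := Finset.sum_nonneg fun _ _ => sq_nonneg _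
  rcases hN.eq_or_lt with h | h
  · rw [form_eq_zero_of_sum_sq M h.symm, ← h, mul_zero]
  · obtain ⟨w, hw, hvw⟩ := form_normalize M h
    rw [hvw]
    exact mul_le_mul_of_nonneg_right
      (le_csSup (isCompact_sphere_form M).bddAbove ⟨w, hw, rfl⟩) hN

lemma lamMin_pos {M : Matrix (Fin 3) (Fin 3) ℝ} (hM : M.PosDef) : 0 < lamMin M := by
  obtain ⟨v, hv, hr⟩ := (isCompact_sphere_form M).sInf_mem
    ⟨_, Pi.single 0 1, by simp [Fin.sum_univ_three], rfl⟩
  rw [lamMin, hr]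
  have hv0 : v ≠ 0 := by
    rintro rfl
    simp at hv
  simpa using hM.dotProduct_mulVec_pos hv0

lemma lamMax_Phi1_nonneg (n : ℕ) (χ lam0 : ℝ) : 0 ≤ lamMax (Phi1 n χ lam0) := by
  have h := le_lamMax_mul (Phi1 n χ lam0) ![0, 1, 0]
  have h1 : ![0, 1, 0] ⬝ᵥ (Phi1 n χ lam0).mulVec ![0, 1, 0] = 1 / 2 := by
    simp [Phi1, Phi0, Fin.sum_univ_three, Matrix.mulVec, dotProduct]
  have h2 : ∑ i, (![0, 1, 0] : Fin 3 → ℝ) i ^ 2 = 1 := by simp [Fin.sum_univ_three]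
  rw [h1, h2] at h
  linarith

/-- Integrand of the Lyapunov functional at the state `(u, w) = (e, e_t)`; the trace on the
faces `x_p = 1` is absorbed in the integral over the cube. -/
def lyapDensity {n : ℕ} (k χ : ℝ) (u w : (Fin n → ℝ) → ℝ) (x : Fin n → ℝ) : ℝ :=
  gradSq u x / 2 + w x ^ 2 / 2 + χ * (2 * xGrad u x + ((n : ℝ) - 1) * u x) * w x +
    χ * k * ((n : ℝ) - 1) / 2 * ∑ p, u (Function.update x p 1) ^ 2

lemma continuous_lyapDensity {n : ℕ} (k χ : ℝ) {u w : (Fin n → ℝ) → ℝ} (hu : ContDiff ℝ 1 u)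
    (hw : Continuous w) : Continuous (lyapDensity k χ u w) := by
  have h1 := hu.continuous_gradSq
  have h2 := hu.continuous_xGrad
  have h3 := hu.continuous
  have h4 : Continuous fun x : Fin n → ℝ => ∑ p, u (Function.update x p 1) ^ 2 :=
    continuous_finsetSum _ fun p _ => (hu.continuous.comp_update p 1).pow 2
  unfold lyapDensity
  fun_prop

lemma abs_xGrad_mul_le {n : ℕ} (u : (Fin n → ℝ) → ℝ) {x : Fin n → ℝ} (hx : x ∈ cube n) (r : ℝ) :
    |xGrad u x * r| ≤ √n * √(gradSq u x) * |r| := by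
  rw [abs_mul]
  exact mul_le_mul_of_nonneg_right (abs_xGrad_le u hx) (abs_nonneg r)

lemma Phi0_form (n : ℕ) (χ lam0 a b c : ℝ) :
    ![a, b, c] ⬝ᵥ (Phi0 n χ lam0).mulVec ![a, b, c] =
      (1 / 2 - 4 / (π ^ 2 * n) * lam0) * a ^ 2 + b ^ 2 / 2 + lam0 * c ^ 2 +
        2 * χ * (√n * a * b) + ((n : ℝ) - 1) * χ * (b * c) := by
  simp [Phi0, Fin.sum_univ_three, Matrix.mulVec, dotProduct]
  ring

lemma Phi1_form (n : ℕ) (χ lam0 a b c : ℝ) :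
    ![a, b, c] ⬝ᵥ (Phi1 n χ lam0).mulVec ![a, b, c] =
      a ^ 2 / 2 + b ^ 2 / 2 + lam0 * c ^ 2 +
        2 * χ * (√n * a * b) + ((n : ℝ) - 1) * χ * (b * c) := by
  rw [Phi1, Matrix.add_mulVec, dotProduct_add, Phi0_form]
  simp [Fin.sum_univ_three, Matrix.mulVec_diagonal, dotProduct]
  ring

lemma Psi2_form (n : ℕ) (k χ δ g1 lam1 a b c : ℝ) :
    ![a, b, c] ⬝ᵥ (Psi2 n k χ δ g1 lam1).mulVec ![a, b, c] =
      (-χ + δ * (1 + χ * k * ((n : ℝ) - 1)) + 4 / (π ^ 2 * n) * lam1) * a ^ 2 +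
        (-χ + δ) * b ^ 2 + (-lam1 + g1 * ((n : ℝ) - 1) * χ) * c ^ 2 +
        4 * δ * χ * (√n * a * b) + 2 * χ * g1 * (√n * a * c) +
        (g1 + 2 * δ * ((n : ℝ) - 1) * χ) * (b * c) := by
  simp [Psi2, Fin.sum_univ_three, Matrix.mulVec, dotProduct]
  ring

lemma sum_sq_vec3 (a b c : ℝ) : ∑ i, (![a, b, c] : Fin 3 → ℝ) i ^ 2 = a ^ 2 + b ^ 2 + c ^ 2 := by
  simp [Fin.sum_univ_three]

lemma lamMin_mul_le_lyapDensity {n : ℕ} (hn : 1 ≤ n) {k χ lam0 : ℝ} (hk : 0 < k) (hχ : 0 < χ)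
    (hΦ0 : (Phi0 n χ lam0).PosDef) (u w : (Fin n → ℝ) → ℝ) {x : Fin n → ℝ} (hx : x ∈ cube n) :
    lamMin (Phi0 n χ lam0) * (gradSq u x + w x ^ 2) ≤
      lyapDensity k χ u w x + lam0 * (u x ^ 2 - 4 / (π ^ 2 * n) * gradSq u x) := by
  have hn' : (0 : ℝ) ≤ (n : ℝ) - 1 := sub_nonneg.2 (by exact_mod_cast hn)
  have hform := lamMin_mul_le (Phi0 n χ lam0) ![√(gradSq u x), -|w x|, |u x|]
  rw [Phi0_form, sum_sq_vec3, Real.sq_sqrt (gradSq_nonneg u x), neg_sq, sq_abs, sq_abs] at hform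
  have hl : 0 ≤ lamMin (Phi0 n χ lam0) * u x ^ 2 :=
    mul_nonneg (lamMin_pos hΦ0).le (sq_nonneg _)
  have hX := mul_le_mul_of_nonneg_left (neg_le_of_abs_le (abs_xGrad_mul_le u hx (w x))) hχ.le
  have hU := mul_le_mul_of_nonneg_left (neg_abs_le (u x * w x)) (mul_nonneg hn' hχ.le)
  rw [abs_mul] at hU
  have htr : 0 ≤ χ * k * ((n : ℝ) - 1) / 2 * ∑ p, u (Function.update x p 1) ^ 2 :=
    mul_nonneg (by positivity) (Finset.sum_nonneg fun _ _ => sq_nonneg _)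
  unfold lyapDensity
  linarith

lemma lyapDensity_le_lamMax_mul {n : ℕ} (hn : 1 ≤ n) {k χ lam0 : ℝ} (hχ : 0 < χ)
    (hl0 : 0 < lam0) (u w : (Fin n → ℝ) → ℝ) {x : Fin n → ℝ} (hx : x ∈ cube n) :
    lyapDensity k χ u w x ≤ lamMax (Phi1 n χ lam0) * (gradSq u x + w x ^ 2 + u x ^ 2) +
      χ * k * ((n : ℝ) - 1) / 2 * ∑ p, u (Function.update x p 1) ^ 2 := by
  have hn' : (0 : ℝ) ≤ (n : ℝ) - 1 := sub_nonneg.2 (by exact_mod_cast hn)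
  have hform := le_lamMax_mul (Phi1 n χ lam0) ![√(gradSq u x), |w x|, |u x|]
  rw [Phi1_form, sum_sq_vec3, Real.sq_sqrt (gradSq_nonneg u x), sq_abs, sq_abs] at hform
  have hl : 0 ≤ lam0 * u x ^ 2 := by positivity
  have hX := mul_le_mul_of_nonneg_left (le_of_abs_le (abs_xGrad_mul_le u hx (w x))) hχ.le
  have hU := mul_le_mul_of_nonneg_left (le_abs_self (u x * w x)) (mul_nonneg hn' hχ.le)
  rw [abs_mul] at hU
  unfold lyapDensity
  linarith

/-- Part of the derivative of the Lyapunov functional left over once all boundary terms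
have been integrated out. -/
def bulkRate {n : ℕ} (χ : ℝ) (G u w : (Fin n → ℝ) → ℝ) (x : Fin n → ℝ) : ℝ :=
  G x * u x * w x + χ * (-w x ^ 2 - gradSq u x + 2 * G x * u x * xGrad u x +
    ((n : ℝ) - 1) * G x * u x ^ 2)

lemma continuous_bulkRate {n : ℕ} (χ : ℝ) {G u w : (Fin n → ℝ) → ℝ} (hG : Continuous G)
    (hu : ContDiff ℝ 1 u) (hw : Continuous w) : Continuous (bulkRate χ G u w) := by
  have h1 := hu.continuous_gradSq
  have h2 := hu.continuous_xGrad
  have h3 := hu.continuous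
  unfold bulkRate
  fun_prop

lemma bulkRate_add_lyapDensity_le {n : ℕ} (hn : 1 ≤ n) {k δ g1 χ lam1 : ℝ} (hδ : 0 < δ)
    (hχ : 0 < χ) (hΨ2 : NegSemidefM (Psi2 n k χ δ g1 lam1)) (G u w : (Fin n → ℝ) → ℝ)
    {x : Fin n → ℝ} (hx : x ∈ cube n) (hG : |G x| ≤ g1) :
    bulkRate χ G u w x + 2 * δ * lyapDensity k χ u w x ≤
      lam1 * (u x ^ 2 - 4 / (π ^ 2 * n) * gradSq u x) +
        δ * χ * k * ((n : ℝ) - 1) * (∑ p, u (Function.update x p 1) ^ 2 - gradSq u x) := by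
  have hn' : (0 : ℝ) ≤ (n : ℝ) - 1 := sub_nonneg.2 (by exact_mod_cast hn)
  have hform := hΨ2.dotProduct_mulVec_nonneg ![√(gradSq u x), |w x|, |u x|]
  rw [star_trivial, Matrix.neg_mulVec, dotProduct_neg, Psi2_form,
    Real.sq_sqrt (gradSq_nonneg u x), sq_abs, sq_abs] at hform
  have hW := mul_le_mul_of_nonneg_left (le_of_abs_le (abs_xGrad_mul_le u hx (w x)))
    (mul_nonneg hδ.le hχ.le)
  have hU := mul_le_mul_of_nonneg_left (le_abs_self (u x * w x))
    (mul_nonneg hδ.le (mul_nonneg hn' hχ.le))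
  have hGX : G x * (xGrad u x * u x) ≤ g1 * (√n * √(gradSq u x) * |u x|) := by
    refine (le_abs_self _).trans ?_
    rw [abs_mul]
    exact mul_le_mul hG (abs_xGrad_mul_le u hx (u x)) (abs_nonneg _) ((abs_nonneg _).trans hG)
  have hGU : G x * (u x * w x) ≤ g1 * (|u x| * |w x|) := by
    refine (le_abs_self _).trans ?_
    rw [abs_mul, abs_mul (u x)]
    exact mul_le_mul_of_nonneg_right hG (by positivity)
  have hGG : G x * u x ^ 2 ≤ g1 * u x ^ 2 :=
    mul_le_mul_of_nonneg_right (le_of_abs_le hG) (sq_nonneg _)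
  have hGX' := mul_le_mul_of_nonneg_left hGX hχ.le
  have hGG' := mul_le_mul_of_nonneg_left hGG (mul_nonneg hn' hχ.le)
  rw [abs_mul] at hU
  unfold lyapDensity bulkRate
  linarith

section Functional

variable {n : ℕ} {u w : (Fin n → ℝ) → ℝ}

lemma continuous_trace (hu : Continuous u) :
    Continuous fun x : Fin n → ℝ => ∑ p, u (Function.update x p 1) ^ 2 :=
  continuous_finsetSum _ fun p _ => (hu.comp_update p 1).pow 2

lemma alphaC_mul_energy_le (hn : 1 ≤ n) {k χ lam0 : ℝ} (hk : 0 < k) (hχ : 0 < χ)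
    (hl0 : 0 < lam0) (hΦ0 : (Phi0 n χ lam0).PosDef) (hu : ContDiff ℝ 1 u) (hw : Continuous w)
    (h0 : ∀ x ∈ cube n, (∃ p, x p = 0) → u x = 0) :
    alphaC n χ lam0 * ∫ x in cube n, (gradSq u x + w x ^ 2) ≤
      2 * ∫ x in cube n, lyapDensity k χ u w x := by
  have hg := hu.continuous_gradSq
  have hV := continuous_lyapDensity k χ hu hw
  have hu2 : Continuous fun x => u x ^ 2 := hu.continuous.pow 2
  have hgc : Continuous fun x => 4 / (π ^ 2 * n) * gradSq u x := hg.const_mul _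
  have hug : Continuous fun x => lam0 * (u x ^ 2 - 4 / (π ^ 2 * n) * gradSq u x) := by fun_prop
  have h := integral_cube_mono (by fun_prop) (by fun_prop) fun x hx =>
    lamMin_mul_le_lyapDensity hn hk hχ hΦ0 u w hx
  rw [integral_const_mul, integral_cube_add hV hug,
    integral_const_mul, integral_cube_sub hu2 hgc, integral_const_mul] at h
  have hp := mul_le_mul_of_nonneg_left (poincare_cube hn hu h0) hl0.le
  rw [alphaC]
  linarith

lemma two_mul_lyapunov_le (hn : 1 ≤ n) {k χ lam0 : ℝ} (hk : 0 < k) (hχ : 0 < χ)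
    (hl0 : 0 < lam0) (hu : ContDiff ℝ 1 u) (hw : Continuous w)
    (h0 : ∀ x ∈ cube n, (∃ p, x p = 0) → u x = 0) :
    2 * ∫ x in cube n, lyapDensity k χ u w x ≤
      betaC n k χ lam0 * ∫ x in cube n, (gradSq u x + w x ^ 2) := by
  have hn' : (0 : ℝ) ≤ (n : ℝ) - 1 := sub_nonneg.2 (by exact_mod_cast hn)
  have hg := hu.continuous_gradSq
  have hV := continuous_lyapDensity k χ hu hw
  have hu2 : Continuous fun x => u x ^ 2 := hu.continuous.pow 2
  have hw2 : Continuous fun x => w x ^ 2 := hw.pow 2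
  have ht := continuous_trace hu.continuous
  have hE : Continuous fun x => gradSq u x + w x ^ 2 := by fun_prop
  have hEu : Continuous fun x => lamMax (Phi1 n χ lam0) * (gradSq u x + w x ^ 2 + u x ^ 2) := by
    fun_prop
  have h := integral_cube_mono hV (by fun_prop)
    fun x hx => lyapDensity_le_lamMax_mul hn hχ hl0 u w hx
  rw [integral_cube_add hEu (ht.const_mul _), integral_const_mul, integral_const_mul,
    integral_cube_add hE hu2] at h
  have hp := poincare_cube hn hu h0
  have htr := integral_cube_trace_le hu h0
  have hgw : ∫ x in cube n, gradSq u x ≤ ∫ x in cube n, (gradSq u x + w x ^ 2) :=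
    integral_cube_mono hg hE fun x _ => by nlinarith [sq_nonneg (w x)]
  have hL := lamMax_Phi1_nonneg n χ lam0
  have hc : (0 : ℝ) ≤ 4 / (π ^ 2 * n) := by positivity
  have hb : 0 ≤ χ * k * ((n : ℝ) - 1) := by positivity
  have h1 := mul_le_mul_of_nonneg_left (hp.trans (mul_le_mul_of_nonneg_left hgw hc)) hL
  have h2 := mul_le_mul_of_nonneg_left (htr.trans hgw) hb
  rw [betaC]
  linarith

lemma integral_bulkRate_le (hn : 1 ≤ n) {k δ g1 χ lam1 : ℝ} (hk : 0 < k) (hδ : 0 < δ)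
    (hχ : 0 < χ) (hl1 : 0 < lam1) (hΨ2 : NegSemidefM (Psi2 n k χ δ g1 lam1))
    {G : (Fin n → ℝ) → ℝ} (hG : Continuous G) (hGb : ∀ x ∈ cube n, |G x| ≤ g1)
    (hu : ContDiff ℝ 1 u) (hw : Continuous w) (h0 : ∀ x ∈ cube n, (∃ p, x p = 0) → u x = 0) :
    (∫ x in cube n, bulkRate χ G u w x) + 2 * δ * ∫ x in cube n, lyapDensity k χ u w x ≤ 0 := by
  have hn' : (0 : ℝ) ≤ (n : ℝ) - 1 := sub_nonneg.2 (by exact_mod_cast hn)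
  have hg := hu.continuous_gradSq
  have hV := continuous_lyapDensity k χ hu hw
  have hB := continuous_bulkRate χ hG hu hw
  have hu2 : Continuous fun x => u x ^ 2 := hu.continuous.pow 2
  have hgc : Continuous fun x => 4 / (π ^ 2 * n) * gradSq u x := hg.const_mul _
  have ht := continuous_trace hu.continuous
  have hug : Continuous fun x => lam1 * (u x ^ 2 - 4 / (π ^ 2 * n) * gradSq u x) := by fun_prop
  have htg : Continuous fun x => δ * χ * k * ((n : ℝ) - 1) *
      (∑ p, u (Function.update x p 1) ^ 2 - gradSq u x) := by fun_prop
  have h := integral_cube_mono (by fun_prop) (by fun_prop) fun x hx =>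
    bulkRate_add_lyapDensity_le hn hδ hχ hΨ2 G u w hx (hGb x hx)
  rw [integral_cube_add hB (hV.const_mul _),
    integral_cube_add hug htg,
    integral_const_mul, integral_const_mul, integral_const_mul, integral_cube_sub hu2 hgc,
    integral_cube_sub ht hg, integral_const_mul] at h
  have hp := mul_nonneg hl1.le (sub_nonneg.2 (poincare_cube hn hu h0))
  have htr := mul_nonneg (by positivity : 0 ≤ δ * χ * k * ((n : ℝ) - 1))
    (sub_nonneg.2 (integral_cube_trace_le hu h0))
  linarith

end Functional

section Flux

lemma fderiv_fderiv_apply_comm {E : Type*} [NormedAddCommGroup E] [NormedSpace ℝ E] {F : E → ℝ}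
    (hF : ContDiff ℝ 2 F) (q v v' : E) :
    fderiv ℝ (fun y => fderiv ℝ F y v) q v' = fderiv ℝ (fun y => fderiv ℝ F y v') q v := by
  have hd : DifferentiableAt ℝ (fderiv ℝ F) q :=
    (hF.fderiv_right (m := 1) (by norm_num)).differentiable one_ne_zero q
  have h (a b : E) : fderiv ℝ (fun y => fderiv ℝ F y a) q b = fderiv ℝ (fderiv ℝ F) q b a := by
    rw [fderiv_clm_apply hd (differentiableAt_const a)]
    simp
  rw [h, h]
  exact (hF.contDiffAt.isSymmSndFDerivAt (by simp)) v' v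

variable {n : ℕ} {u w : (Fin n → ℝ) → ℝ}

lemma pd_comm (hu : ContDiff ℝ 2 u) (p q : Fin n) (x : Fin n → ℝ) :
    pd p (pd q u) x = pd q (pd p u) x :=
  fderiv_fderiv_apply_comm hu x _ _

lemma ContDiff.pd_one (p : Fin n) (hu : ContDiff ℝ 2 u) : ContDiff ℝ 1 (_root_.pd p u) :=
  ContDiff.pd (m := 1) p (by norm_num; exact hu)

lemma hasDerivAt_line (p : Fin n) (hu : ContDiff ℝ 1 u) (x : Fin n → ℝ) :
    HasDerivAt (fun s => u (Function.update x p s)) (pd p u x) (x p) := by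
  simpa using hasDerivAt_comp_update p hu x (x p)

/-- The `p`-th component of the vector field whose divergence carries the boundary terms of
the derivative of the Lyapunov functional. -/
def flux (χ : ℝ) (u w : (Fin n → ℝ) → ℝ) (p : Fin n) (x : Fin n → ℝ) : ℝ :=
  w x * pd p u x + χ * (x p * w x ^ 2 + 2 * xGrad u x * pd p u x - x p * gradSq u x +
    ((n : ℝ) - 1) * u x * pd p u x)

lemma contDiff_flux (χ : ℝ) (hu : ContDiff ℝ 2 u) (hw : ContDiff ℝ 1 w) (p : Fin n) :
    ContDiff ℝ 1 (flux χ u w p) := by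
  have hp (q : Fin n) := hu.pd_one q
  have hu1 : ContDiff ℝ 1 u := hu.of_le one_le_two
  have hx (q : Fin n) : ContDiff ℝ 1 fun x : Fin n → ℝ => x q := contDiff_apply ℝ ℝ q
  unfold flux xGrad gradSq
  fun_prop

lemma hasDerivAt_xGrad_line (hu : ContDiff ℝ 2 u) (p : Fin n) (x : Fin n → ℝ) :
    HasDerivAt (fun s => xGrad u (Function.update x p s))
      (pd p u x + ∑ q, x q * pd q (pd p u) x) (x p) := by
  have hX (q : Fin n) : HasDerivAt (fun s => Function.update x p s q)
      ((Pi.single p (1 : ℝ) : Fin n → ℝ) q) (x p) :=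
    hasDerivAt_pi.1 (hasDerivAt_update x p (x p)) q
  have h := HasDerivAt.fun_sum (u := Finset.univ) fun q _ =>
    (hX q).mul (hasDerivAt_line p (hu.pd_one q) x)
  refine h.congr_deriv ?_
  simp [Finset.sum_add_distrib, Pi.single_apply, pd_comm hu p]

lemma hasDerivAt_gradSq_line (hu : ContDiff ℝ 2 u) (p : Fin n) (x : Fin n → ℝ) :
    HasDerivAt (fun s => gradSq u (Function.update x p s))
      (2 * ∑ q, pd q u x * pd p (pd q u) x) (x p) := by
  have h := HasDerivAt.fun_sum (u := Finset.univ) fun q _ =>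
    (hasDerivAt_line p (hu.pd_one q) x).pow 2
  refine h.congr_deriv ?_
  simp [Finset.mul_sum, mul_assoc]

lemma pd_flux (χ : ℝ) (hu : ContDiff ℝ 2 u) (hw : ContDiff ℝ 1 w) (p : Fin n) (x : Fin n → ℝ) :
    pd p (flux χ u w p) x =
      pd p u x * pd p w x + w x * pd p (pd p u) x + χ * (w x ^ 2 + 2 * w x * (x p * pd p w x) +
        2 * pd p u x ^ 2 + 2 * (∑ q, x q * pd q (pd p u) x * pd p u x) +
        2 * xGrad u x * pd p (pd p u) x - gradSq u x -
        2 * (∑ q, x p * pd p (pd q u) x * pd q u x) +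
        ((n : ℝ) - 1) * (pd p u x ^ 2 + u x * pd p (pd p u) x)) := by
  have hU := hasDerivAt_line p (hu.of_le one_le_two) x
  have hW := hasDerivAt_line p hw x
  have hP := hasDerivAt_line p (hu.pd_one p) x
  have hX : HasDerivAt (fun s => Function.update x p s p) 1 (x p) := by
    simpa using hasDerivAt_id' (x p)
  have hF := (hW.mul hP).add ((((((hX.mul (hW.pow 2)).add
    (((hasDerivAt_xGrad_line hu p x).const_mul 2).mul hP)).sub
    (hX.mul (hasDerivAt_gradSq_line hu p x))).add
    ((hU.const_mul ((n : ℝ) - 1)).mul hP))).const_mul χ)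
  rw [(hasDerivAt_line p (contDiff_flux χ hu hw p) x).unique hF]
  have h1 : ∑ q, x p * pd p (pd q u) x * pd q u x =
      x p * ∑ q, pd q u x * pd p (pd q u) x := by
    rw [Finset.mul_sum]
    exact Finset.sum_congr rfl fun q _ => by ring
  rw [h1, ← Finset.sum_mul]
  simp only [Pi.pow_apply, Function.update_eq_self]
  ring

/-- Derivative of `lyapDensity` along a motion with velocity `(w, a)`. -/
def lyapRate (k χ : ℝ) (u w a : (Fin n → ℝ) → ℝ) (x : Fin n → ℝ) : ℝ :=
  ∑ p, pd p u x * pd p w x + w x * a x +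
    χ * ((2 * xGrad w x + ((n : ℝ) - 1) * w x) * w x +
      (2 * xGrad u x + ((n : ℝ) - 1) * u x) * a x) +
    χ * k * ((n : ℝ) - 1) * ∑ p, u (Function.update x p 1) * w (Function.update x p 1)

lemma lyapRate_eq (k χ : ℝ) (hu : ContDiff ℝ 2 u) (hw : ContDiff ℝ 1 w)
    {G a : (Fin n → ℝ) → ℝ} {x : Fin n → ℝ} (ha : a x = lap u x + G x * u x) :
    lyapRate k χ u w a x = ∑ p, pd p (flux χ u w p) x + bulkRate χ G u w x +
      χ * k * ((n : ℝ) - 1) * ∑ p, u (Function.update x p 1) * w (Function.update x p 1) := by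
  have hswap : ∑ p, ∑ q, x q * pd q (pd p u) x * pd p u x =
      ∑ p, ∑ q, x p * pd p (pd q u) x * pd q u x := Finset.sum_comm
  simp only [pd_flux χ hu hw, Finset.sum_add_distrib, Finset.sum_sub_distrib, ← Finset.mul_sum,
    hswap, Finset.sum_const, Finset.card_univ, Fintype.card_fin, nsmul_eq_mul]
  change lyapRate k χ u w a x = ∑ p, pd p u x * pd p w x + w x * lap u x +
    χ * (n * w x ^ 2 + 2 * w x * xGrad w x + 2 * gradSq u x +
      2 * (∑ p, ∑ q, x p * pd p (pd q u) x * pd q u x) + 2 * xGrad u x * lap u x -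
      n * gradSq u x - 2 * (∑ p, ∑ q, x p * pd p (pd q u) x * pd q u x) +
      ((n : ℝ) - 1) * (gradSq u x + u x * lap u x)) + bulkRate χ G u w x + _
  rw [lyapRate, ha, bulkRate]
  ring

lemma flux_eq_zero (χ : ℝ) (h0 : ∀ x ∈ cube n, (∃ p, x p = 0) → u x = 0)
    (hw0 : ∀ x ∈ cube n, (∃ p, x p = 0) → w x = 0) (hu : ContDiff ℝ 1 u)
    {p : Fin n} {x : Fin n → ℝ} (hx : x ∈ cube n) (hxp : x p = 0) :
    flux χ u w p x = 0 := by
  have hX : xGrad u x = 0 := by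
    refine Finset.sum_eq_zero fun q _ => ?_
    rcases eq_or_ne q p with rfl | hq
    · rw [hxp, zero_mul]
    · have hmaps : ∀ s ∈ Set.Icc (0 : ℝ) 1, u (Function.update x q s) = 0 := fun s hs =>
        h0 _ (update_mem_cube hx q hs) ⟨p, by simpa [hq.symm] using hxp⟩
      have hd := (hasDerivAt_line q hu x).hasDerivWithinAt (s := Set.Icc 0 1)
      have hz : HasDerivWithinAt (fun s => u (Function.update x q s)) 0 (Set.Icc 0 1) (x q) :=
        (hasDerivWithinAt_const (x q) _ (0 : ℝ)).congr hmaps (hmaps _ (hx q trivial))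
      rw [(uniqueDiffOn_Icc zero_lt_one _ (hx q trivial)).eq_deriv _ hd hz, mul_zero]
  rw [flux, hX, hxp, h0 x hx ⟨p, hxp⟩, hw0 x hx ⟨p, hxp⟩]
  ring

lemma flux_add_le_zero {k χ : ℝ} (hn : 1 ≤ n) (hχ : 0 < χ)
    (hΨ1 : -k + (1 + k ^ 2 * n) * χ ≤ 0) {p : Fin n} {x : Fin n → ℝ} (hx : x ∈ cube n)
    (hxp : x p = 1) (hNeu : pd p u x = -k * w x) :
    flux χ u w p x + χ * k * ((n : ℝ) - 1) * (u x * w x) ≤ 0 := by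
  have hn' : (0 : ℝ) < n := by exact_mod_cast hn
  have hq : 0 ≤ gradSq u x + 2 * k * xGrad u x * w x + k ^ 2 * n * w x ^ 2 := by
    refine nonneg_of_mul_nonneg_right (a := (n : ℝ)) ?_ hn'
    nlinarith [xGrad_sq_le u hx, sq_nonneg (xGrad u x + k * n * w x)]
  have h1 := mul_nonneg hχ.le hq
  have h2 := mul_le_mul_of_nonneg_right hΨ1 (sq_nonneg (w x))
  rw [flux, hxp, hNeu]
  linarith

/-- All boundary contributions to the derivative of the Lyapunov functional are dissipative. -/
lemma integral_lyapRate_le {k χ : ℝ} (hn : 1 ≤ n) (hχ : 0 < χ)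
    (hΨ1 : -k + (1 + k ^ 2 * n) * χ ≤ 0) (hu : ContDiff ℝ 2 u) (hw : ContDiff ℝ 1 w)
    {G a : (Fin n → ℝ) → ℝ} (hG : Continuous G)
    (ha : ∀ x ∈ cube n, a x = lap u x + G x * u x)
    (h0 : ∀ x ∈ cube n, (∃ p, x p = 0) → u x = 0)
    (hw0 : ∀ x ∈ cube n, (∃ p, x p = 0) → w x = 0)
    (hNeu : ∀ x ∈ cube n, ∀ p, x p = 1 → pd p u x = -k * w x) :
    ∫ x in cube n, lyapRate k χ u w a x ≤ ∫ x in cube n, bulkRate χ G u w x := by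
  have hu1 : ContDiff ℝ 1 u := hu.of_le one_le_two
  have hF (p : Fin n) := contDiff_flux χ hu hw p
  have hB := continuous_bulkRate χ hG hu1 hw.continuous
  have hface (p : Fin n) : Continuous fun x => χ * k * ((n : ℝ) - 1) *
      (u (Function.update x p 1) * w (Function.update x p 1)) :=
    ((hu.continuous.comp_update p 1).mul (hw.continuous.comp_update p 1)).const_mul _
  have hpdF : Continuous fun x => ∑ p, pd p (flux χ u w p) x :=
    continuous_finsetSum _ fun p _ => (hF p).continuous_pd p
  have hfaces : Continuous fun x => ∑ p, χ * k * ((n : ℝ) - 1) *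
      (u (Function.update x p 1) * w (Function.update x p 1)) :=
    continuous_finsetSum _ fun p _ => hface p
  have hsplit : ∫ x in cube n, lyapRate k χ u w a x =
      ∫ x in cube n, (∑ p, pd p (flux χ u w p) x + bulkRate χ G u w x +
        ∑ p, χ * k * ((n : ℝ) - 1) *
          (u (Function.update x p 1) * w (Function.update x p 1))) :=
    setIntegral_congr_fun (measurableSet_cube n) fun x hx => by
      simp only [lyapRate_eq k χ hu hw (ha x hx), Finset.mul_sum]
  have hpB : Continuous fun x => ∑ p, pd p (flux χ u w p) x + bulkRate χ G u w x := hpdF.add hB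
  rw [hsplit, integral_cube_add hpB hfaces, integral_cube_add hpdF hB,
    integral_cube_sum fun p => (hF p).continuous_pd p, integral_cube_sum hface]
  have hbdry : (∑ p, ∫ x in cube n, pd p (flux χ u w p) x) + ∑ p, ∫ x in cube n,
      χ * k * ((n : ℝ) - 1) * (u (Function.update x p 1) * w (Function.update x p 1)) ≤ 0 := by
    rw [← Finset.sum_add_distrib]
    refine Finset.sum_nonpos fun p _ => ?_
    have hdiff : Continuous fun x => flux χ u w p (Function.update x p 1) -
        flux χ u w p (Function.update x p 0) :=
      ((hF p).continuous.comp_update p 1).sub ((hF p).continuous.comp_update p 0)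
    rw [integral_cube_pd p (hF p), ← integral_cube_add hdiff (hface p)]
    refine setIntegral_nonpos (measurableSet_cube n) fun x hx => ?_
    have h1 : Function.update x p 1 ∈ cube n := update_mem_cube hx p (by simp)
    rw [flux_eq_zero (p := p) (x := Function.update x p 0) χ h0 hw0 hu1
      (update_mem_cube hx p (by simp)) (by simp), sub_zero]
    exact flux_add_le_zero hn hχ hΨ1 h1 (by simp) (hNeu _ h1 p (by simp))
  linarith

end Flux

section Time

variable {n : ℕ}

lemma hasDerivAt_integral_cube {H H' : ℝ → (Fin n → ℝ) → ℝ}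
    (hd : ∀ t x, HasDerivAt (fun s => H s x) (H' t x) t) (hH : ∀ t, Continuous (H t))
    (hH' : Continuous fun q : ℝ × (Fin n → ℝ) => H' q.1 q.2) (t : ℝ) :
    HasDerivAt (fun s => ∫ x in cube n, H s x) (∫ x in cube n, H' t x) t := by
  obtain ⟨C, hC⟩ := ((isCompact_Icc (a := t - 1) (b := t + 1)).prod
    (isCompact_cube n)).exists_bound_of_continuousOn hH'.continuousOn
  have hconst : IntegrableOn (fun _ : Fin n → ℝ => C) (cube n) :=
    continuous_const.integrableOn_cube
  refine (hasDerivAt_integral_of_dominated_loc_of_deriv_le (bound := fun _ => C)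
    (Icc_mem_nhds (by linarith : t - 1 < t) (by linarith : t < t + 1))
    (Filter.Eventually.of_forall fun s => (hH s).aestronglyMeasurable)
    (hH t).integrableOn_cube
    (hH'.comp (Continuous.prodMk_right t)).aestronglyMeasurable ?_ hconst
    (Filter.Eventually.of_forall fun x s _ => hd s x)).2
  filter_upwards [ae_restrict_mem (measurableSet_cube n)] with x hx s hs
  exact hC (s, x) ⟨hs, hx⟩

lemma hasDerivAt_time {f : ℝ → (Fin n → ℝ) → ℝ}
    (hf : ContDiff ℝ 1 fun q : ℝ × (Fin n → ℝ) => f q.1 q.2) (t : ℝ) (x : Fin n → ℝ) :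
    HasDerivAt (fun s => f s x)
      (fderiv ℝ (fun q : ℝ × (Fin n → ℝ) => f q.1 q.2) (t, x) (1, 0)) t :=
  ((hf.differentiable one_ne_zero (t, x)).hasFDerivAt).comp_hasDerivAt (f := fun s => (s, x)) t
    ((hasDerivAt_id' t).prodMk (hasDerivAt_const t x))

lemma pd_eq_fderiv_prod {f : ℝ → (Fin n → ℝ) → ℝ}
    (hf : ContDiff ℝ 1 fun q : ℝ × (Fin n → ℝ) => f q.1 q.2) (p : Fin n) (t : ℝ)
    (x : Fin n → ℝ) :
    pd p (f t) x =
      fderiv ℝ (fun q : ℝ × (Fin n → ℝ) => f q.1 q.2) (t, x) (0, Pi.single p 1) := by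
  have h := ((hf.differentiable one_ne_zero (t, x)).hasFDerivAt).comp x
    ((hasFDerivAt_const t x).prodMk (hasFDerivAt_id x))
  have h' : fderiv ℝ (f t) x = _ := h.fderiv
  rw [pd, h']
  simp

lemma ContDiff.time_slice {m : WithTop ℕ∞} {f : ℝ → (Fin n → ℝ) → ℝ}
    (hf : ContDiff ℝ m fun q : ℝ × (Fin n → ℝ) => f q.1 q.2) (t : ℝ) : ContDiff ℝ m (f t) :=
  hf.comp (contDiff_prodMk_right t)

lemma ContDiff.continuous_pd_prod {f : ℝ → (Fin n → ℝ) → ℝ}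
    (hf : ContDiff ℝ 1 fun q : ℝ × (Fin n → ℝ) => f q.1 q.2) (p : Fin n) :
    Continuous fun q : ℝ × (Fin n → ℝ) => _root_.pd p (f q.1) q.2 := by
  simp only [pd_eq_fderiv_prod hf]
  exact (hf.continuous_fderiv one_ne_zero).clm_apply continuous_const

variable {e : ℝ → (Fin n → ℝ) → ℝ}

lemma ContDiff.velocity (he : ContDiff ℝ 2 fun q : ℝ × (Fin n → ℝ) => e q.1 q.2) :
    ContDiff ℝ 1 fun q : ℝ × (Fin n → ℝ) => deriv (fun s => e s q.2) q.1 := by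
  simp only [fun q : ℝ × (Fin n → ℝ) => (hasDerivAt_time (he.of_le one_le_two) q.1 q.2).deriv]
  exact (he.fderiv_right (m := 1) (by norm_num)).clm_apply contDiff_const

lemma ContDiff.continuous_acceleration
    (he : ContDiff ℝ 2 fun q : ℝ × (Fin n → ℝ) => e q.1 q.2) :
    Continuous fun q : ℝ × (Fin n → ℝ) => deriv (deriv fun s => e s q.2) q.1 := by
  have h (q : ℝ × (Fin n → ℝ)) := (hasDerivAt_time
    (f := fun t x => deriv (fun s => e s x) t) he.velocity q.1 q.2).deriv
  change Continuous fun q : ℝ × (Fin n → ℝ) => deriv (fun t => deriv (fun s => e s q.2) t) q.1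
  simp only [h]
  exact (he.velocity.continuous_fderiv one_ne_zero).clm_apply continuous_const

lemma hasDerivAt_pd_time (he : ContDiff ℝ 2 fun q : ℝ × (Fin n → ℝ) => e q.1 q.2) (p : Fin n)
    (t : ℝ) (x : Fin n → ℝ) :
    HasDerivAt (fun s => pd p (e s) x) (pd p (fun y => deriv (fun s => e s y) t) x) t := by
  have he1 : ContDiff ℝ 1 fun q : ℝ × (Fin n → ℝ) => e q.1 q.2 := he.of_le one_le_two
  have hp : ContDiff ℝ 1 fun q : ℝ × (Fin n → ℝ) => pd p (e q.1) q.2 := by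
    simp only [pd_eq_fderiv_prod he1]
    exact (he.fderiv_right (m := 1) (by norm_num)).clm_apply contDiff_const
  refine (hasDerivAt_time (f := fun s x => pd p (e s) x) hp t x).congr_deriv ?_
  rw [pd_eq_fderiv_prod (f := fun t x => deriv (fun s => e s x) t) he.velocity]
  simp only [pd_eq_fderiv_prod he1,
    fun q : ℝ × (Fin n → ℝ) => (hasDerivAt_time he1 q.1 q.2).deriv]
  exact fderiv_fderiv_apply_comm he _ _ _

lemma hasDerivAt_lyapDensity (k χ : ℝ)
    (he : ContDiff ℝ 2 fun q : ℝ × (Fin n → ℝ) => e q.1 q.2) (t : ℝ) (x : Fin n → ℝ) :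
    HasDerivAt (fun s => lyapDensity k χ (e s) (fun y => deriv (fun r => e r y) s) x)
      (lyapRate k χ (e t) (fun y => deriv (fun r => e r y) t)
        (fun y => deriv (deriv fun r => e r y) t) x) t := by
  have hE (y : Fin n → ℝ) : HasDerivAt (fun s => e s y) (deriv (fun s => e s y) t) t :=
    (hasDerivAt_time (he.of_le one_le_two) t y).differentiableAt.hasDerivAt
  have hW : HasDerivAt (fun s => deriv (fun r => e r x) s) (deriv (deriv fun r => e r x) t) t :=
    (hasDerivAt_time (f := fun t x => deriv (fun s => e s x) t) he.velocity
      t x).differentiableAt.hasDerivAt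
  have hG := HasDerivAt.fun_sum (u := Finset.univ) fun p _ => (hasDerivAt_pd_time he p t x).pow 2
  have hX := HasDerivAt.fun_sum (u := Finset.univ) fun p _ =>
    (hasDerivAt_pd_time he p t x).const_mul (x p)
  have hT := HasDerivAt.fun_sum (u := Finset.univ) fun p _ =>
    (hE (Function.update x p 1)).pow 2
  have h := (((hG.div_const 2).add ((hW.pow 2).div_const 2)).add
    ((((hX.const_mul 2).add ((hE x).const_mul ((n : ℝ) - 1))).const_mul χ).mul hW)).add
    (hT.const_mul (χ * k * ((n : ℝ) - 1) / 2))
  refine h.congr_deriv ?_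
  simp only [lyapRate, xGrad, Nat.cast_ofNat, Nat.add_one_sub_one, pow_one, mul_assoc,
    ← Finset.mul_sum, Pi.add_apply]
  ring

lemma continuous_lyapRate (k χ : ℝ)
    (he : ContDiff ℝ 2 fun q : ℝ × (Fin n → ℝ) => e q.1 q.2) :
    Continuous fun q : ℝ × (Fin n → ℝ) =>
      lyapRate k χ (e q.1) (fun y => deriv (fun r => e r y) q.1)
        (fun y => deriv (deriv fun r => e r y) q.1) q.2 := by
  have h1 := he.continuous
  have h2 := he.velocity.continuous
  have h3 := he.continuous_acceleration
  have h4 (p : Fin n) := (he.of_le one_le_two : ContDiff ℝ 1 _).continuous_pd_prod p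
  have h5 (p : Fin n) := ContDiff.continuous_pd_prod
    (f := fun t x => deriv (fun s => e s x) t) he.velocity p
  have hup (p : Fin n) : Continuous fun q : ℝ × (Fin n → ℝ) =>
      (q.1, Function.update q.2 p (1 : ℝ)) :=
    continuous_fst.prodMk (continuous_snd.update p continuous_const)
  have h6 (p : Fin n) : Continuous fun q : ℝ × (Fin n → ℝ) => e q.1 (Function.update q.2 p 1) :=
    h1.comp (hup p)
  have h7 (p : Fin n) : Continuous fun q : ℝ × (Fin n → ℝ) =>
      deriv (fun r => e r (Function.update q.2 p 1)) q.1 := h2.comp (hup p)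
  unfold lyapRate xGrad
  fun_prop

end Time

lemma le_exp_mul_of_deriv_le {V V' : ℝ → ℝ} {c t0 : ℝ} (hV : ∀ t, HasDerivAt V (V' t) t)
    (hle : ∀ t, t0 < t → V' t + c * V t ≤ 0) {t : ℝ} (ht : t0 ≤ t) :
    V t ≤ exp (-c * (t - t0)) * V t0 := by
  have hd (s : ℝ) : HasDerivAt (fun s => exp (c * (s - t0)) * V s)
      (exp (c * (s - t0)) * (V' s + c * V s)) s := by
    have h := ((((hasDerivAt_id' s).sub_const t0).const_mul c).exp).mul (hV s)
    exact h.congr_deriv (by ring)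
  have hanti : AntitoneOn (fun s => exp (c * (s - t0)) * V s) (Set.Ici t0) := by
    refine antitoneOn_of_deriv_nonpos (convex_Ici t0)
      (fun s _ => (hd s).continuousAt.continuousWithinAt)
      (fun s _ => (hd s).differentiableAt.differentiableWithinAt) fun s hs => ?_
    rw [interior_Ici] at hs
    rw [(hd s).deriv]
    exact mul_nonpos_of_nonneg_of_nonpos (exp_pos _).le (hle s hs)
  have h := mul_le_mul_of_nonneg_left (hanti Set.self_mem_Ici ht ht)
    (exp_pos (-c * (t - t0))).le
  simp only [← mul_assoc, ← exp_add] at h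
  simpa using h

/-- **Theorem 1 (LMI-based exponential stability of the n-D error wave equation).**
If there exist `χ, λ₀, λ₁ > 0` with `Φ₀ > 0`, `Ψ₁ = −k + (1 + k²n)χ ≤ 0` and
`Ψ₂ ⪯ 0`, then every classical (C²) solution of
`e_tt = Δe + g(x,t)e` on `Ω × (t₀,∞)` (with `|g| ≤ g₁`, `e = 0` on `Γ_D`, and
`e_{x_p} = −k e_t` on each face `{x_p = 1}`) satisfies
`∫_Ω (|∇e(t)|² + e_t(t)²) ≤ (β/α) e^{−2δ(t−t₀)} ∫_Ω (|∇e(t₀)|² + e_t(t₀)²)`. -/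
theorem exp_stability_nd (n : ℕ) (hn : 1 ≤ n) (k δ g1 : ℝ)
    (hk : 0 < k) (hδ : 0 < δ) (hg1 : 0 < g1)
    (χ lam0 lam1 : ℝ) (hχ : 0 < χ) (hl0 : 0 < lam0) (hl1 : 0 < lam1)
    (hΦ0 : (Phi0 n χ lam0).PosDef)
    (hΨ1 : -k + (1 + k ^ 2 * n) * χ ≤ 0)
    (hΨ2 : NegSemidefM (Psi2 n k χ δ g1 lam1))
    (t0 : ℝ) (e : ℝ → (Fin n → ℝ) → ℝ)
    (he : ContDiff ℝ 2 fun q : ℝ × (Fin n → ℝ) => e q.1 q.2)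
    (g : (Fin n → ℝ) → ℝ → ℝ)
    (hg : Continuous fun q : (Fin n → ℝ) × ℝ => g q.1 q.2)
    (hgb : ∀ x ∈ cube n, ∀ t, t0 ≤ t → |g x t| ≤ g1)
    (hwave : ∀ t, t0 < t → ∀ x ∈ cube n,
      deriv (deriv fun s => e s x) t = lap (e t) x + g x t * e t x)
    (hDir : ∀ t, t0 ≤ t → ∀ x ∈ cube n, (∃ p, x p = 0) → e t x = 0)
    (hNeu : ∀ t, t0 ≤ t → ∀ x ∈ cube n, ∀ p, x p = 1 →
      pd p (e t) x = -k * deriv (fun s => e s x) t) :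
    ∀ t, t0 ≤ t →
      (∫ x in cube n, (gradSq (e t) x + (deriv (fun s => e s x) t) ^ 2)) ≤
        (betaC n k χ lam0 / alphaC n χ lam0) * Real.exp (-2 * δ * (t - t0)) *
          ∫ x in cube n, (gradSq (e t0) x + (deriv (fun s => e s x) t0) ^ 2) := by
  intro t ht
  have hslice (s : ℝ) : ContDiff ℝ 2 (e s) := he.time_slice s
  have hslice1 (s : ℝ) : ContDiff ℝ 1 (e s) := (hslice s).of_le one_le_two
  have hvel (s : ℝ) : ContDiff ℝ 1 fun x => deriv (fun r => e r x) s :=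
    ContDiff.time_slice (f := fun t x => deriv (fun r => e r x) t) he.velocity s
  set V : ℝ → ℝ := fun s =>
    ∫ x in cube n, lyapDensity k χ (e s) (fun y => deriv (fun r => e r y) s) x
  have hderiv (s : ℝ) : HasDerivAt V _ s :=
    hasDerivAt_integral_cube (hasDerivAt_lyapDensity k χ he)
      (fun s => continuous_lyapDensity k χ (hslice1 s) (hvel s).continuous)
      (continuous_lyapRate k χ he) s
  have hdecay : V t ≤ exp (-(2 * δ) * (t - t0)) * V t0 := by
    refine le_exp_mul_of_deriv_le hderiv (fun s hs => ?_) ht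
    have hG : Continuous fun x => g x s := hg.comp (Continuous.prodMk_left s)
    have hvel0 : ∀ x ∈ cube n, (∃ p, x p = 0) → deriv (fun r => e r x) s = 0 := by
      intro x hx hp
      have hev : (fun r => e r x) =ᶠ[nhds s] fun _ => 0 := by
        filter_upwards [Ioi_mem_nhds hs] with r hr using hDir r hr.le x hx hp
      rw [hev.deriv_eq, deriv_const]
    have hrate := integral_lyapRate_le (G := fun x => g x s) hn hχ hΨ1 (hslice s) (hvel s) hG
      (hwave s hs) (hDir s hs.le) hvel0 (hNeu s hs.le)
    have hbulk := integral_bulkRate_le (G := fun x => g x s) hn hk hδ hχ hl1 hΨ2 hG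
      (fun x hx => hgb x hx s hs.le) (hslice1 s) (hvel s).continuous (hDir s hs.le)
    exact (add_le_add_left hrate _).trans hbulk
  have hα : 0 < alphaC n χ lam0 := mul_pos two_pos (lamMin_pos hΦ0)
  have hlow := alphaC_mul_energy_le hn hk hχ hl0 hΦ0 (hslice1 t) (hvel t).continuous (hDir t ht)
  have hup := two_mul_lyapunov_le hn hk hχ hl0 (hslice1 t0) (hvel t0).continuous
    (hDir t0 le_rfl)
  have hup' := mul_le_mul_of_nonneg_left hup (exp_pos (-(2 * δ) * (t - t0))).le
  rw [div_mul_eq_mul_div, div_mul_eq_mul_div, le_div_iff₀ hα,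
    show -2 * δ = -(2 * δ) by ring]
  linarith
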